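/- Let E D_n denote the expected number of distinct part sizes in a composition of n chosen uniformly at random among all 2^{n−1} compositions of n. There exists a sequence of positive reals a_n with a_n/(n/2) → 1 such that E D_n − ∑_{m=1}^{∞} (1 − (1 − 2^{−m})^{a_n}) → 0 as n → ∞. -/

import Mathlib

open Real Filter

/-- The expected number of distinct part sizes in a uniformly random
composition of `n` (the average over all `2^(n-1)` compositions). -/
noncomputable def expectedDistinctParts (n : ℕ) : ℝ :=
  (∑ c : Composition n, (c.blocks.toFinset.card : ℝ)) / 2 ^ (n - 1)

/-- Block lists of the compositions of `n` avoiding the part `m`. -/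
noncomputable def avoidLists (m n : ℕ) : Finset (List ℕ) :=
  (Finset.univ.filter (fun c : Composition n => m ∉ c.blocks)).image Composition.blocks

theorem mem_avoidLists (m n : ℕ) (l : List ℕ) :
    l ∈ avoidLists m n ↔ (∀ i ∈ l, 0 < i) ∧ l.sum = n ∧ m ∉ l := by
  simp only [avoidLists, Finset.mem_image, Finset.mem_filter, Finset.mem_univ, true_and]
  constructor
  · rintro ⟨c, hc, rfl⟩
    exact ⟨fun i hi => c.blocks_pos hi, c.blocks_sum, hc⟩
  · rintro ⟨h1, h2, h3⟩
    exact ⟨⟨l, fun {i} hi => h1 i hi, h2⟩, h3, rfl⟩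

/-- Number of compositions of `n` avoiding the part `m`. -/
noncomputable def avoidCard (m n : ℕ) : ℕ := (avoidLists m n).card

theorem avoidCard_eq (m n : ℕ) :
    avoidCard m n = (Finset.univ.filter (fun c : Composition n => m ∉ c.blocks)).card := by
  unfold avoidCard avoidLists
  apply Finset.card_image_of_injective
  intro c d h
  exact Composition.ext h

theorem avoidCard_zero (m : ℕ) : avoidCard m 0 = 1 := by
  have : avoidLists m 0 = {[]} := by
    ext l
    rw [mem_avoidLists, Finset.mem_singleton]
    constructor
    · rintro ⟨h1, h2, -⟩
      cases l with
      | nil => rfl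
      | cons a t =>
        have := h1 a (by simp)
        simp at h2
        omega
    · rintro rfl
      simp
  simp [avoidCard, this]

theorem avoidCard_succ (m n : ℕ) :
    avoidCard m (n + 1) =
      ∑ j ∈ (Finset.range (n + 1)).filter (fun j => n + 1 - j ≠ m), avoidCard m j := by
  have key : avoidLists m (n + 1) =
      ((Finset.range (n + 1)).filter (fun j => n + 1 - j ≠ m)).biUnion
        (fun j => (avoidLists m j).image (List.cons (n + 1 - j))) := by
    ext l
    simp only [mem_avoidLists, Finset.mem_biUnion, Finset.mem_image, Finset.mem_filter,
      Finset.mem_range]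
    constructor
    · rintro ⟨h1, h2, h3⟩
      cases l with
      | nil => simp at h2
      | cons a t =>
        have ha := h1 a (by simp)
        simp only [List.sum_cons] at h2
        simp only [List.mem_cons, not_or] at h3
        refine ⟨t.sum, ⟨by omega, by omega⟩, t, ⟨fun i hi => h1 i (by simp [hi]), rfl, h3.2⟩, ?_⟩
        congr 1
        omega
    · rintro ⟨j, ⟨hj, hjm⟩, t, ⟨h1, h2, h3⟩, rfl⟩
      refine ⟨?_, ?_, ?_⟩
      · intro i hi
        rcases List.mem_cons.1 hi with rfl | hi
        · omega
        · exact h1 i hi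
      · simp only [List.sum_cons]; omega
      · simp only [List.mem_cons, not_or]
        exact ⟨fun h => hjm h.symm, h3⟩
  unfold avoidCard
  rw [key, Finset.card_biUnion]
  · apply Finset.sum_congr rfl
    intro j _
    exact Finset.card_image_of_injective _ (List.cons_injective)
  · intro i hi j hj hij
    rw [Function.onFun, Finset.disjoint_left]
    intro l hl hl'
    simp only [Finset.mem_image, Finset.coe_filter, Finset.mem_range, Set.mem_ofPred_eq] at hl hl' hi hj
    obtain ⟨t, -, rfl⟩ := hl
    obtain ⟨t', -, h⟩ := hl'
    have := (List.cons.inj h).1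
    omega

theorem avoidCard_succ_of_lt (m n : ℕ) (h : n + 1 < m) :
    avoidCard m (n + 1) = ∑ j ∈ Finset.range (n + 1), avoidCard m j := by
  rw [avoidCard_succ, Finset.filter_true_of_mem]
  intro j _
  omega

theorem avoidCard_succ_of_le (m n : ℕ) (hm : 1 ≤ m) (h : m ≤ n + 1) :
    avoidCard m (n + 1) + avoidCard m (n + 1 - m) =
      ∑ j ∈ Finset.range (n + 1), avoidCard m j := by
  have : (Finset.range (n + 1)).filter (fun j => n + 1 - j ≠ m)
      = (Finset.range (n + 1)).erase (n + 1 - m) := by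
    ext j
    simp only [Finset.mem_filter, Finset.mem_erase, Finset.mem_range]
    omega
  rw [avoidCard_succ, this, Finset.sum_erase_add]
  simp only [Finset.mem_range]
  omega

theorem avoidCard_le (m n : ℕ) : avoidCard m n ≤ 2 ^ (n - 1) := by
  rw [avoidCard_eq, ← composition_card n]
  exact Finset.card_filter_le _ _

/-- Probability that a random composition of `n` avoids `m` (equal to `2` at `n = 0`). -/
noncomputable def pAv (m n : ℕ) : ℝ := 2 * avoidCard m n / 2 ^ n

theorem pAv_nonneg (m n : ℕ) : 0 ≤ pAv m n := by unfold pAv; positivity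

theorem pAv_zero (m : ℕ) : pAv m 0 = 2 := by simp [pAv, avoidCard_zero]

theorem pAv_succ_eq (m n : ℕ) : pAv m (n + 1) = avoidCard m (n + 1) / 2 ^ n := by
  unfold pAv; rw [pow_succ]; field_simp

theorem pAv_le_one (m n : ℕ) : pAv m (n + 1) ≤ 1 := by
  rw [pAv_succ_eq, div_le_one (by positivity)]
  exact_mod_cast avoidCard_le m (n + 1)

theorem avoidCard_of_lt (m n : ℕ) (h : n + 1 < m) : avoidCard m (n + 1) = 2 ^ n := by
  induction n with
  | zero =>
    rw [avoidCard_succ_of_lt m 0 h]; simp [avoidCard_zero]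
  | succ k ih =>
    rw [avoidCard_succ_of_lt m (k + 1) h, Finset.sum_range_succ,
      ← avoidCard_succ_of_lt m k (by omega), ih (by omega)]
    ring

theorem pAv_of_lt (m n : ℕ) (h : n + 1 < m) : pAv m (n + 1) = 1 := by
  rw [pAv_succ_eq, avoidCard_of_lt m n h]; simp

theorem pAv_self (m : ℕ) : pAv (m + 1) (m + 1) = 1 - 2 * (2 : ℝ)⁻¹ ^ (m + 1) := by
  have h := avoidCard_succ_of_le (m + 1) m (by omega) le_rfl
  have h2 : ∑ j ∈ Finset.range (m + 1), avoidCard (m + 1) j = 2 ^ m := by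
    cases m with
    | zero => simp [avoidCard_zero]
    | succ k =>
      rw [Finset.sum_range_succ, ← avoidCard_succ_of_lt _ k (by omega),
        avoidCard_of_lt _ k (by omega)]
      ring
  rw [h2, Nat.sub_self, avoidCard_zero] at h
  have h' : (avoidCard (m + 1) (m + 1) : ℝ) = 2 ^ m - 1 := by
    have : ((avoidCard (m + 1) (m + 1) + 1 : ℕ) : ℝ) = ((2 ^ m : ℕ) : ℝ) := by rw [h]
    push_cast at this
    linarith
  rw [pAv_succ_eq, h', inv_pow, pow_succ]
  field_simp

/-- Main recurrence; `m + 1` is the avoided part, `q = 2^-(m+1)`. -/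
theorem pAv_rec (m k : ℕ) :
    pAv (m + 1) (k + (m + 1) + 1) = pAv (m + 1) (k + (m + 1))
      - (2 : ℝ)⁻¹ ^ (m + 1) * (pAv (m + 1) (k + 1) - pAv (m + 1) k / 2) := by
  have h1 := avoidCard_succ_of_le (m + 1) (k + m) (by omega) (by omega)
  have h2 := avoidCard_succ_of_le (m + 1) (k + m + 1) (by omega) (by omega)
  rw [Finset.sum_range_succ, ← h1] at h2
  rw [show k + m + 1 + 1 - (m + 1) = k + 1 by omega, show k + m + 1 - (m + 1) = k by omega] at h2
  have h3 : (avoidCard (m + 1) (k + m + 1 + 1) : ℝ) + avoidCard (m + 1) (k + 1)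
    = avoidCard (m + 1) (k + m + 1) + avoidCard (m + 1) k + avoidCard (m + 1) (k + m + 1) := by
    exact_mod_cast h2
  rw [show k + (m + 1) + 1 = k + m + 1 + 1 by ring, show k + (m + 1) = k + m + 1 by ring]
  unfold pAv
  have h4 : (avoidCard (m + 1) (k + m + 1 + 1) : ℝ) = 2 * avoidCard (m + 1) (k + m + 1)
     + avoidCard (m + 1) k - avoidCard (m + 1) (k + 1) := by linarith
  rw [h4, inv_pow]
  simp only [pow_succ, pow_add]
  field_simp
  ring

theorem pAv_diff (m k : ℕ) :
    |pAv (m + 1) (k + 2) - pAv (m + 1) (k + 1)| ≤ 2 * (2 : ℝ)⁻¹ ^ (m + 1) := by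
  have hq : (0 : ℝ) < (2 : ℝ)⁻¹ ^ (m + 1) := by positivity
  rcases lt_trichotomy (k + 2) (m + 1) with h | h | h
  · rw [pAv_of_lt _ (k + 1) (by omega), pAv_of_lt _ k (by omega)]
    simp
  · obtain rfl : m = k + 1 := by omega
    rw [pAv_self, pAv_of_lt _ k (by omega)]
    rw [abs_le]; constructor <;> linarith
  · obtain ⟨j, rfl⟩ : ∃ j, k = j + m := ⟨k - m, by omega⟩
    have := pAv_rec m j
    rw [show j + (m + 1) + 1 = j + m + 2 by ring, show j + (m + 1) = j + m + 1 by ring] at this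
    rw [this]
    have a1 := pAv_nonneg (m + 1) (j + 1)
    have a2 := pAv_le_one (m + 1) j
    have a3 := pAv_nonneg (m + 1) j
    have a4 : pAv (m + 1) j ≤ 2 := by
      cases j with
      | zero => rw [pAv_zero]
      | succ i => linarith [pAv_le_one (m + 1) i]
    rw [abs_le]; constructor <;> nlinarith

theorem pAv_diff_iter (m k i : ℕ) :
    |pAv (m + 1) (k + i + 1) - pAv (m + 1) (k + 1)| ≤ i * (2 * (2 : ℝ)⁻¹ ^ (m + 1)) := by
  induction i with
  | zero => simp
  | succ i ih =>
    have h := pAv_diff m (k + i)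
    have := abs_sub_le (pAv (m + 1) (k + i + 2)) (pAv (m + 1) (k + i + 1)) (pAv (m + 1) (k + 1))
    rw [show k + (i + 1) + 1 = k + i + 2 by ring]
    push_cast
    linarith

theorem pAv_bound (m n : ℕ) :
    |pAv (m + 1) (n + 1) - √(1 - (2 : ℝ)⁻¹ ^ (m + 1)) ^ (n + 1)|
      ≤ 4 * ((m + 1 : ℕ) * (2 : ℝ)⁻¹ ^ (m + 1)) := by
  set q : ℝ := (2 : ℝ)⁻¹ ^ (m + 1) with hqdef
  have hq : 0 < q := by positivity
  have hq2 : q ≤ 1 / 2 := by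
    rw [hqdef, pow_succ]
    have : (2 : ℝ)⁻¹ ^ m ≤ 1 := pow_le_one₀ (by norm_num) (by norm_num)
    linarith
  set s := √(1 - q) with hs
  have hs0 : 0 ≤ s := Real.sqrt_nonneg _
  have hss : s * s = 1 - q := Real.mul_self_sqrt (by linarith)
  have hs1 : s ≤ 1 := by nlinarith
  have hsq : 1 - q ≤ s := by nlinarith
  have hs2 : s ≤ 1 - q / 2 := by nlinarith
  have hs3 : 1 - q / 2 - q ^ 2 ≤ s := by
    by_contra hcon
    push Not at hcon
    nlinarith
  have hM : (1 : ℝ) ≤ ((m + 1 : ℕ) : ℝ) := by push_cast; linarith [(Nat.cast_nonneg m : (0 : ℝ) ≤ m)]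
  set M : ℝ := ((m + 1 : ℕ) : ℝ) with hMdef
  have base : ∀ n, n ≤ m + 1 → |pAv (m + 1) (n + 1) - s ^ (n + 1)| ≤ 4 * (M * q) := by
    intro n hn
    have hp1 : pAv (m + 1) (n + 1) ≤ 1 := pAv_le_one _ _
    have hp2 : 1 - 4 * q ≤ pAv (m + 1) (n + 1) := by
      rcases lt_trichotomy n m with h | h | h
      · rw [pAv_of_lt _ _ (by omega)]; linarith
      · subst h
        rw [pAv_self]; linarith
      · obtain rfl : n = m + 1 := by omega
        have h := pAv_diff m m
        rw [pAv_self, ← hqdef, abs_le] at h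
        linarith [h.1]
    have hu1 : s ^ (n + 1) ≤ 1 := pow_le_one₀ hs0 hs1
    have hu2 : 1 - (n + 1 : ℕ) * q ≤ s ^ (n + 1) := by
      have := one_add_mul_le_pow (a := -q) (by linarith) (n + 1)
      have h2 : (1 + -q) ^ (n + 1) ≤ s ^ (n + 1) :=
        pow_le_pow_left₀ (by linarith) (by linarith) _
      linarith
    have hnM : ((n + 1 : ℕ) : ℝ) ≤ M + 1 := by
      rw [hMdef]; exact_mod_cast (by omega : n + 1 ≤ m + 1 + 1)
    rw [abs_le]; constructor <;> nlinarith
  induction n with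
  | zero => exact base 0 (by omega)
  | succ n ih =>
    by_cases hn : n + 1 ≤ m + 1
    · exact base _ hn
    obtain ⟨k, rfl⟩ : ∃ k, n = k + 1 + m := ⟨n - 1 - m, by omega⟩
    have hrec := pAv_rec m (k + 1)
    rw [← hqdef] at hrec
    have e1 := pAv_diff m k
    have e2 := pAv_diff_iter m (k + 1) m
    rw [← hqdef] at e1 e2
    rw [show k + 1 + (m + 1) + 1 = k + 1 + m + 1 + 1 by ring,
      show k + 1 + (m + 1) = k + 1 + m + 1 by ring] at hrec
    rw [show k + 1 + 1 = k + 2 by ring] at hrec e2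
    have hmM : (m : ℝ) = M - 1 := by rw [hMdef]; push_cast; ring
    rw [hmM] at e2
    set P := pAv (m + 1) (k + 1 + m + 1)
    set P2 := pAv (m + 1) (k + 2)
    set P1 := pAv (m + 1) (k + 1)
    set U := s ^ (k + 1 + m + 1) with hU
    have hU0 : 0 ≤ U := by positivity
    have hU1 : U ≤ 1 := pow_le_one₀ hs0 hs1
    rw [hrec, pow_succ, ← hU]
    have split : P - q * (P2 - P1 / 2) - U * s
        = (1 - q / 2) * (P - U) + (q / 2 * (P - P2) - q / 2 * (P2 - P1))
          + U * (1 - q / 2 - s) := by ring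
    rw [split]
    rw [abs_le] at ih e1 e2 ⊢
    have i1 : (1 - q / 2) * (P - U) ≤ (1 - q / 2) * (4 * (M * q)) :=
      mul_le_mul_of_nonneg_left ih.2 (by linarith)
    have i2 : (1 - q / 2) * (-(4 * (M * q))) ≤ (1 - q / 2) * (P - U) :=
      mul_le_mul_of_nonneg_left ih.1 (by linarith)
    have j1 : q / 2 * (P - P2) ≤ q / 2 * ((M - 1) * (2 * q)) :=
      mul_le_mul_of_nonneg_left e2.2 (by linarith)
    have j2 : q / 2 * (-((M - 1) * (2 * q))) ≤ q / 2 * (P - P2) :=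
      mul_le_mul_of_nonneg_left e2.1 (by linarith)
    have k1 : q / 2 * (P2 - P1) ≤ q / 2 * (2 * q) :=
      mul_le_mul_of_nonneg_left e1.2 (by linarith)
    have k2 : q / 2 * (-(2 * q)) ≤ q / 2 * (P2 - P1) :=
      mul_le_mul_of_nonneg_left e1.1 (by linarith)
    have l1 : 0 ≤ U * (1 - q / 2 - s) := mul_nonneg hU0 (by linarith)
    have l2 : U * (1 - q / 2 - s) ≤ 1 * q ^ 2 :=
      mul_le_mul hU1 (by linarith) (by linarith) (by norm_num)
    have hMq : q ^ 2 ≤ M * q ^ 2 := le_mul_of_one_le_left (by positivity) hM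
    constructor <;> nlinarith

theorem pAv_tendsto (m : ℕ) : Tendsto (fun n => pAv (m + 1) n) atTop (nhds 0) := by
  set q : ℝ := (2 : ℝ)⁻¹ ^ (m + 1) with hqdef
  have hq : 0 < q := by positivity
  have inv : ∀ k, pAv (m + 1) (k + (m + 1)) + q * pAv (m + 1) k
      + q / 2 * ∑ i ∈ Finset.range k, pAv (m + 1) i
      = pAv (m + 1) (m + 1) + q * pAv (m + 1) 0 := by
    intro k
    induction k with
    | zero => simp
    | succ k ih =>
      have := pAv_rec m k
      rw [← hqdef] at this
      rw [Finset.sum_range_succ, show k + 1 + (m + 1) = k + (m + 1) + 1 by ring, this, ← ih]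
      ring
  have hsum : Summable (fun n => pAv (m + 1) n) := by
    apply summable_of_sum_range_le (c := (pAv (m + 1) (m + 1) + q * pAv (m + 1) 0) / (q / 2))
      (fun n => pAv_nonneg _ n)
    intro k
    rw [le_div_iff₀ (by positivity)]
    have a1 := pAv_nonneg (m + 1) (k + (m + 1))
    have a2 := mul_nonneg hq.le (pAv_nonneg (m + 1) k)
    linarith [inv k]
  exact hsum.tendsto_atTop_zero

theorem expected_eq (n : ℕ) :
    expectedDistinctParts (n + 1) = ∑ m ∈ Finset.range (n + 1), (1 - pAv (m + 1) (n + 1)) := by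
  have h1 : ∀ c : Composition (n + 1), (c.blocks.toFinset.card : ℝ)
      = ∑ m ∈ Finset.range (n + 1), (1 - if (m + 1) ∉ c.blocks then (1 : ℝ) else 0) := by
    intro c
    have e : c.blocks.toFinset
        = ((Finset.range (n + 1)).filter (fun m => m + 1 ∈ c.blocks)).image (fun m => m + 1) := by
      ext i
      simp only [List.mem_toFinset, Finset.mem_image, Finset.mem_filter, Finset.mem_range]
      constructor
      · intro hi
        have a1 := c.one_le_blocks hi
        have a2 := c.blocks_le hi
        exact ⟨i - 1, ⟨by omega, by rwa [Nat.sub_add_cancel a1]⟩, Nat.sub_add_cancel a1⟩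
      · rintro ⟨j, ⟨-, hj⟩, rfl⟩
        exact hj
    rw [e, Finset.card_image_of_injective _ (add_left_injective 1), Finset.card_filter]
    push_cast
    apply Finset.sum_congr rfl
    intro m _
    by_cases h : m + 1 ∈ c.blocks <;> simp [h]
  unfold expectedDistinctParts
  rw [Finset.sum_congr rfl (fun c _ => h1 c), Finset.sum_comm, Finset.sum_div]
  apply Finset.sum_congr rfl
  intro m _
  rw [Finset.sum_sub_distrib, pAv_succ_eq, avoidCard_eq, Finset.card_filter]
  simp only [Finset.sum_const, Finset.card_univ, composition_card, nsmul_eq_mul, mul_one,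
    Nat.add_sub_cancel]
  push_cast
  rw [sub_div, div_self (by positivity)]

theorem expectedDistinctParts_approx :
    ∃ a : ℕ → ℝ, (∀ n, 0 < a n) ∧
      Tendsto (fun n : ℕ => a n / ((n : ℝ) / 2)) atTop (nhds 1) ∧
      Tendsto (fun n : ℕ =>
          expectedDistinctParts n
            - ∑' m : ℕ, (1 - (1 - (2 : ℝ)⁻¹ ^ (m + 1)) ^ (a n)))
        atTop (nhds 0) := by
  refine ⟨fun n => if n = 0 then 1 else (n : ℝ) / 2, ?_, ?_, ?_⟩
  · intro n
    by_cases h : n = 0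
    · simp [h]
    · have : (0 : ℝ) < n := by exact_mod_cast Nat.pos_of_ne_zero h
      simp only [h, if_false]
      positivity
  · apply tendsto_const_nhds.congr'
    filter_upwards [eventually_gt_atTop 0] with n hn
    have : (0 : ℝ) < n := by exact_mod_cast hn
    rw [if_neg hn.ne', div_self (by positivity)]
  · rw [← tendsto_add_atTop_iff_nat 1]
    have hbs : Summable (fun m : ℕ => 4 * (((m + 1 : ℕ) : ℝ) * (2 : ℝ)⁻¹ ^ (m + 1))) := by
      apply Summable.mul_left
      have := summable_pow_mul_geometric_of_norm_lt_one (R := ℝ) 1 (r := (2 : ℝ)⁻¹)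
        (by norm_num)
      simp only [pow_one] at this
      exact (summable_nat_add_iff 1).2 this
    have hd : ∀ n : ℕ, Summable (fun m : ℕ => pAv (m + 1) (n + 1)
        - √(1 - (2 : ℝ)⁻¹ ^ (m + 1)) ^ (n + 1)) := fun n =>
      Summable.of_norm_bounded hbs (fun m => by simpa only [Real.norm_eq_abs] using pAv_bound m n)
    have hlim : Tendsto (fun n : ℕ => ∑' m : ℕ, (pAv (m + 1) (n + 1)
        - √(1 - (2 : ℝ)⁻¹ ^ (m + 1)) ^ (n + 1))) atTop (nhds (∑' _ : ℕ, (0 : ℝ))) := by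
      apply tendsto_tsum_of_dominated_convergence hbs
      · intro m
        have t1 := (tendsto_add_atTop_iff_nat 1).2 (pAv_tendsto m)
        have hq : (0 : ℝ) < (2 : ℝ)⁻¹ ^ (m + 1) := by positivity
        have hs : √(1 - (2 : ℝ)⁻¹ ^ (m + 1)) < 1 := by
          rw [Real.sqrt_lt' one_pos]; linarith
        have t2 := (tendsto_add_atTop_iff_nat 1).2
          (tendsto_pow_atTop_nhds_zero_of_lt_one (Real.sqrt_nonneg _) hs)
        simpa using t1.sub t2
      · exact Eventually.of_forall fun n m => by
          simpa only [Real.norm_eq_abs] using pAv_bound m n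
    rw [tsum_zero] at hlim
    have hneg := hlim.neg
    rw [neg_zero] at hneg
    refine hneg.congr ?_
    intro n
    have hfin : HasSum (fun m : ℕ => 1 - pAv (m + 1) (n + 1))
        (expectedDistinctParts (n + 1)) := by
      rw [expected_eq]
      apply hasSum_sum_of_ne_finset_zero
      intro m hm
      rw [Finset.mem_range] at hm
      rw [pAv_of_lt _ _ (by omega)]
      simp
    have hadd := hfin.add (hd n).hasSum
    have heq : ∑' m : ℕ, (1 - (1 - (2 : ℝ)⁻¹ ^ (m + 1)) ^
          (if n + 1 = 0 then (1 : ℝ) else ((n + 1 : ℕ) : ℝ) / 2))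
        = expectedDistinctParts (n + 1) + ∑' m : ℕ, (pAv (m + 1) (n + 1)
        - √(1 - (2 : ℝ)⁻¹ ^ (m + 1)) ^ (n + 1)) := by
      rw [← hadd.tsum_eq]
      apply tsum_congr
      intro m
      have hq1 : (2 : ℝ)⁻¹ ^ (m + 1) ≤ 1 := pow_le_one₀ (by norm_num) (by norm_num)
      rw [if_neg (Nat.succ_ne_zero n), Real.sqrt_eq_rpow, ← Real.rpow_natCast _ (n + 1),
        ← Real.rpow_mul (by linarith)]
      rw [show (1 / 2 : ℝ) * ((n + 1 : ℕ) : ℝ) = ((n + 1 : ℕ) : ℝ) / 2 by ring]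
      ring
    rw [heq]
    ring
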